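/- Let u ∈ C^∞(ℝⁿ \ {0}) be a solution to the special Lagrangian equation ∑_{i=1}^n arctan λᵢ(x) = c on ℝⁿ \ {0} that is homogeneous of order 2, i.e. u(x) = |x|² u(x/|x|) for all x ≠ 0, and suppose 3 + λᵢ(x)² + 2λᵢ(x)λⱼ(x) ≥ 0 for all indices i, j and all x ≠ 0. Then the Laplacian Δu = ∑_{i=1}^n λᵢ is constant on ℝⁿ \ {0}. -/

import Mathlib

noncomputable section

/-- The Hessian matrix `D²u(x)`, with entries `∂ᵢ∂ⱼ u (x)`. -/
def Hess {n : ℕ} (u : EuclideanSpace ℝ (Fin n) → ℝ) (x : EuclideanSpace ℝ (Fin n)) :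
    Matrix (Fin n) (Fin n) ℝ :=
  Matrix.of fun i j =>
    iteratedFDeriv ℝ 2 u x ![EuclideanSpace.single i 1, EuclideanSpace.single j 1]

/-- The induced metric `g = I + D²u · D²u` on the gradient graph `(x, ∇u(x))`. -/
def gMat {n : ℕ} (u : EuclideanSpace ℝ (Fin n) → ℝ) (x : EuclideanSpace ℝ (Fin n)) :
    Matrix (Fin n) (Fin n) ℝ :=
  1 + Hess u x * Hess u x

/-- The Laplace–Beltrami operator `Δ_g v = ∑ g^{ij} ∂ᵢ∂ⱼ v` of the induced metric. -/
def lapg {n : ℕ} (u v : EuclideanSpace ℝ (Fin n) → ℝ) (x : EuclideanSpace ℝ (Fin n)) : ℝ :=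
  ∑ i, ∑ j, (gMat u x)⁻¹ i j *
    iteratedFDeriv ℝ 2 v x ![EuclideanSpace.single i 1, EuclideanSpace.single j 1]

/-- The squared metric gradient norm `|∇_g v|²_g = ∑ g^{ij} ∂ᵢv ∂ⱼv`. -/
def gradSq {n : ℕ} (u v : EuclideanSpace ℝ (Fin n) → ℝ) (x : EuclideanSpace ℝ (Fin n)) : ℝ :=
  ∑ i, ∑ j, (gMat u x)⁻¹ i j * fderiv ℝ v x (EuclideanSpace.single i 1) *
    fderiv ℝ v x (EuclideanSpace.single j 1)

/-- The volume element `V = √(det g)`. -/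
def Vol {n : ℕ} (u : EuclideanSpace ℝ (Fin n) → ℝ) (x : EuclideanSpace ℝ (Fin n)) : ℝ :=
  Real.sqrt ((gMat u x).det)

end

open scoped ContDiff

/-- Directional derivative. -/
noncomputable def pd {n : ℕ} (v : EuclideanSpace ℝ (Fin n)) (f : EuclideanSpace ℝ (Fin n) → ℝ) :
    EuclideanSpace ℝ (Fin n) → ℝ := fun x => fderiv ℝ f x v

theorem pd_smooth {n : ℕ} {v : EuclideanSpace ℝ (Fin n)} {f : EuclideanSpace ℝ (Fin n) → ℝ}
    (hf : ContDiffOn ℝ ∞ f {0}ᶜ) : ContDiffOn ℝ ∞ (pd v f) {0}ᶜ := by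
  have h1 : ContDiffOn ℝ ∞ (fderiv ℝ f) {0}ᶜ :=
    hf.fderiv_of_isOpen isOpen_compl_singleton (by simp)
  exact h1.clm_apply contDiffOn_const

theorem smooth_diffAt {n : ℕ} {f : EuclideanSpace ℝ (Fin n) → ℝ}
    (hf : ContDiffOn ℝ ∞ f {0}ᶜ) {x : EuclideanSpace ℝ (Fin n)} (hx : x ≠ 0) :
    DifferentiableAt ℝ f x :=
  (hf.contDiffAt (isOpen_compl_singleton.mem_nhds hx)).differentiableAt (by simp)

theorem pd_pd_eq {n : ℕ} {v w : EuclideanSpace ℝ (Fin n)} {f : EuclideanSpace ℝ (Fin n) → ℝ}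
    (hf : ContDiffOn ℝ ∞ f {0}ᶜ) {x : EuclideanSpace ℝ (Fin n)} (hx : x ≠ 0) :
    pd v (pd w f) x = fderiv ℝ (fderiv ℝ f) x v w := by
  have h1 : ContDiffOn ℝ ∞ (fderiv ℝ f) {0}ᶜ :=
    hf.fderiv_of_isOpen isOpen_compl_singleton (by simp)
  have h2 : DifferentiableAt ℝ (fderiv ℝ f) x :=
    (h1.contDiffAt (isOpen_compl_singleton.mem_nhds hx)).differentiableAt (by simp)
  unfold pd
  rw [fderiv_clm_apply h2 (by fun_prop)]
  simp

theorem pd_comm {n : ℕ} {v w : EuclideanSpace ℝ (Fin n)} {f : EuclideanSpace ℝ (Fin n) → ℝ}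
    (hf : ContDiffOn ℝ ∞ f {0}ᶜ) {x : EuclideanSpace ℝ (Fin n)} (hx : x ≠ 0) :
    pd v (pd w f) x = pd w (pd v f) x := by
  rw [pd_pd_eq hf hx, pd_pd_eq hf hx]
  exact ((hf.contDiffAt (isOpen_compl_singleton.mem_nhds hx)).isSymmSndFDerivAt
    (by simpa using (WithTop.coe_le_coe.2 (le_top : (2 : ℕ∞) ≤ ⊤) : ((2 : ℕ∞) : WithTop ℕ∞) ≤ _))).eq v w

theorem pd_congr {n : ℕ} {v : EuclideanSpace ℝ (Fin n)} {f g : EuclideanSpace ℝ (Fin n) → ℝ}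
    (h : ∀ x, x ≠ 0 → f x = g x) {x : EuclideanSpace ℝ (Fin n)} (hx : x ≠ 0) :
    pd v f x = pd v g x := by
  unfold pd
  have : f =ᶠ[nhds x] g := by
    filter_upwards [isOpen_compl_singleton.mem_nhds hx] with y hy using h y hy
  rw [this.fderiv_eq]

theorem line_deriv {n : ℕ} {f : EuclideanSpace ℝ (Fin n) → ℝ}
    (hf : ContDiffOn ℝ ∞ f {0}ᶜ) (x v : EuclideanSpace ℝ (Fin n)) {t : ℝ} (hx : x + t • v ≠ 0) :
    HasDerivAt (fun s : ℝ => f (x + s • v)) (pd v f (x + t • v)) t := by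
  have h1 := (smooth_diffAt hf hx).hasFDerivAt
  have h2 : HasDerivAt (fun s : ℝ => x + s • v) v t := by
    simpa using ((hasDerivAt_id t).smul_const v).const_add x
  exact h1.comp_hasDerivAt t h2

theorem line_ne {n : ℕ} {x : EuclideanSpace ℝ (Fin n)} (hx : x ≠ 0)
    (v : EuclideanSpace ℝ (Fin n)) : ∀ᶠ t : ℝ in nhds 0, x + t • v ≠ 0 := by
  have : Continuous (fun t : ℝ => x + t • v) := by fun_prop
  have h2 := this.continuousAt (x := 0)
  apply h2.eventually_ne
  simpa using hx

theorem second_le {φ φ1 : ℝ → ℝ} {φ2 : ℝ} (hmax : IsLocalMax φ 0)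
    (h1 : ∀ᶠ t in nhds 0, HasDerivAt φ (φ1 t) t) (h2 : HasDerivAt φ1 φ2 0) : φ2 ≤ 0 := by
  by_contra hcon
  push Not at hcon
  have e1 : deriv φ =ᶠ[nhds 0] φ1 := by
    filter_upwards [h1] with t ht using ht.deriv
  have e2 : deriv (deriv φ) 0 = φ2 := by
    rw [e1.deriv_eq, h2.deriv]
  have hmin : IsLocalMin φ 0 := by
    apply isLocalMin_of_deriv_deriv_pos
    · rw [e2]; exact hcon
    · exact hmax.deriv_eq_zero
    · exact h1.self_of_nhds.continuousAt
  have e3 : φ =ᶠ[nhds 0] fun _ => φ 0 := by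
    filter_upwards [hmax, hmin] with t ht1 ht2 using le_antisymm ht1 ht2
  have e4 : deriv (deriv φ) 0 = 0 := by
    rw [e3.deriv.deriv_eq]; simp
  linarith

theorem barrier_deriv (α a b d s : ℝ) (t : ℝ) :
    HasDerivAt (fun t : ℝ => Real.exp (-α * (a + 2 * t * b + t ^ 2 * d)) - s)
      (Real.exp (-α * (a + 2 * t * b + t ^ 2 * d)) * (-α * (2 * b + 2 * t * d))) t := by
  have h : HasDerivAt (fun t : ℝ => -α * (a + 2 * t * b + t ^ 2 * d)) (-α * (2 * b + 2 * t * d)) t := by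
    have h1 := (((hasDerivAt_id t).const_mul 2).mul_const b).const_add a
    have h2 := ((hasDerivAt_id t).pow 2).mul_const d
    have h3 := (h1.add h2).const_mul (-α)
    refine HasDerivAt.congr_deriv (h3.congr_of_eventuallyEq (Filter.Eventually.of_forall ?_)) ?_
    · intro s; simp
    · simp
  exact (h.exp).sub_const s

theorem barrier_deriv2 (α a b d : ℝ) :
    HasDerivAt (fun t : ℝ => Real.exp (-α * (a + 2 * t * b + t ^ 2 * d)) * (-α * (2 * b + 2 * t * d)))
      (Real.exp (-α * a) * (4 * α ^ 2 * b ^ 2 - 2 * α * d)) 0 := by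
  have h1 := barrier_deriv α a b d 0 0
  have h2 : HasDerivAt (fun t : ℝ => -α * (2 * b + 2 * t * d)) (-α * (2 * d)) 0 := by
    have := ((((hasDerivAt_id (0 : ℝ)).const_mul 2).mul_const d).const_add (2 * b)).const_mul (-α)
    simpa using this
  simp only [sub_zero] at h1
  refine HasDerivAt.congr_deriv (h1.mul h2) ?_
  simp
  ring

theorem hopf {n : ℕ} {f : EuclideanSpace ℝ (Fin n) → ℝ} (hf : ContDiffOn ℝ ∞ f {0}ᶜ)
    {θ : ℝ} (hθ : 0 < θ)
    (hL : ∀ x, x ≠ 0 → ∃ (b : OrthonormalBasis (Fin n) ℝ (EuclideanSpace ℝ (Fin n)))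
      (w : Fin n → ℝ), (∀ k, θ ≤ w k ∧ w k ≤ 1) ∧ 0 ≤ ∑ k, w k * pd (b k) (pd (b k) f) x)
    {M : ℝ} (hM : ∀ x, x ≠ 0 → f x ≤ M)
    {x0 y : EuclideanSpace ℝ (Fin n)} (hx0 : x0 ≠ 0) (hfx0 : f x0 = M) {R : ℝ} (hR : 0 < R)
    (hd : dist x0 y = R)
    (hlt : ∀ x, dist x y ≤ R → x ≠ x0 → f x < M) : False := by
  have hx0n : 0 < ‖x0‖ := norm_pos_iff.mpr hx0
  obtain ⟨ρ, hρ0, hρ1, hρ2⟩ : ∃ ρ : ℝ, 0 < ρ ∧ ρ ≤ R / 2 ∧ ρ ≤ ‖x0‖ / 2 :=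
    ⟨min (R / 2) (‖x0‖ / 2), by positivity, min_le_left _ _, min_le_right _ _⟩
  have hKne : ∀ x, dist x x0 ≤ ρ → x ≠ 0 := by
    rintro x hx rfl
    rw [dist_zero_left] at hx
    linarith
  have hKy : ∀ x, dist x x0 ≤ ρ → R / 2 ≤ dist x y := by
    intro x hx
    have := dist_triangle x0 x y
    rw [dist_comm x0 x] at this
    linarith
  set α : ℝ := (2 * n + 1) / (θ * R ^ 2) with hα
  have hα0 : 0 < α := by positivity
  have hα1 : α * (θ * R ^ 2) = 2 * n + 1 := by
    rw [hα]; field_simp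
  set h : EuclideanSpace ℝ (Fin n) → ℝ :=
    fun x => Real.exp (-α * dist x y ^ 2) - Real.exp (-α * R ^ 2) with hh
  have hle1 : ∀ x, h x ≤ 1 := by
    intro x
    have h1 : Real.exp (-α * dist x y ^ 2) ≤ 1 := by
      rw [Real.exp_le_one_iff]
      have : 0 ≤ α * dist x y ^ 2 := by positivity
      linarith
    have h2 := Real.exp_pos (-α * R ^ 2)
    simp only [hh]; linarith
  have hneg : ∀ x, R < dist x y → h x < 0 := by
    intro x hx
    simp only [hh, sub_neg, Real.exp_lt_exp]
    have : R ^ 2 < dist x y ^ 2 := by gcongr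
    nlinarith
  have hx0h : h x0 = 0 := by simp [hh, hd]
  have hfc : ContinuousOn f {0}ᶜ := hf.continuousOn
  -- delta
  obtain ⟨δ, hδ, hδf⟩ : ∃ δ : ℝ, 0 < δ ∧ ∀ x, dist x x0 = ρ → dist x y ≤ R → f x ≤ M - δ := by
    have hS : IsCompact (Metric.sphere x0 ρ ∩ Metric.closedBall y R) :=
      (isCompact_sphere x0 ρ).inter_right Metric.isClosed_closedBall
    rcases (Metric.sphere x0 ρ ∩ Metric.closedBall y R).eq_empty_or_nonempty with he | hne
    · refine ⟨1, one_pos, fun x h1 h2 => ?_⟩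
      have : x ∈ Metric.sphere x0 ρ ∩ Metric.closedBall y R := ⟨h1, h2⟩
      rw [he] at this
      exact this.elim
    · obtain ⟨z, hz, hzm⟩ := hS.exists_isMaxOn hne
        (hfc.mono (fun x hx => hKne x (le_of_eq hx.1)))
      have hzx : z ≠ x0 := by
        rintro rfl
        have := hz.1
        simp at this
        linarith
      refine ⟨M - f z, sub_pos.mpr (hlt z hz.2 hzx), fun x h1 h2 => ?_⟩
      have := hzm (show x ∈ Metric.sphere x0 ρ ∩ Metric.closedBall y R from ⟨h1, h2⟩)
      simp only [Set.mem_ofPred_eq] at this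
      linarith
  set ε : ℝ := δ / 2 with hε
  have hε0 : 0 < ε := by positivity
  have hcont : ContinuousOn (fun x => f x + ε * h x) (Metric.closedBall x0 ρ) := by
    apply ContinuousOn.add (hfc.mono (fun x hx => hKne x hx))
    simp only [hh]
    fun_prop
  obtain ⟨z, hz, hzm⟩ := (isCompact_closedBall x0 ρ).exists_isMaxOn
    ⟨x0, by simp [hρ0.le]⟩ hcont
  have hzM : M ≤ f z + ε * h z := by
    have := hzm (show x0 ∈ Metric.closedBall x0 ρ by simp [hρ0.le])
    simp only [Set.mem_ofPred_eq, hx0h, hfx0] at this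
    linarith
  have hzball : dist z x0 < ρ := by
    refine lt_of_le_of_ne hz fun heq => ?_
    rcases le_or_gt (dist z y) R with h1 | h1
    · have h2 := hδf z heq h1
      have h3 := mul_le_mul_of_nonneg_left (hle1 z) hε0.le
      linarith
    · have h2 := hM z (hKne z hz)
      have h3 := mul_neg_of_pos_of_neg hε0 (hneg z h1)
      linarith
  have hz0 : z ≠ 0 := hKne z hz
  have hlm : IsLocalMax (fun x => f x + ε * h x) z :=
    hzm.isLocalMax (Metric.closedBall_mem_nhds_of_mem hzball)
  have key : ∀ v : EuclideanSpace ℝ (Fin n),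
      pd v (pd v f) z + ε * (Real.exp (-α * ‖z - y‖ ^ 2) *
        (4 * α ^ 2 * (inner ℝ (z - y) v) ^ 2 - 2 * α * ‖v‖ ^ 2)) ≤ 0 := by
    intro v
    have hexp : ∀ t : ℝ, h (z + t • v) = Real.exp (-α * (‖z - y‖ ^ 2 + 2 * t * inner ℝ (z - y) v
        + t ^ 2 * ‖v‖ ^ 2)) - Real.exp (-α * R ^ 2) := by
      intro t
      simp only [hh]
      congr 3
      rw [dist_eq_norm, show z + t • v - y = (z - y) + t • v by abel, norm_add_sq_real,
        inner_smul_right, norm_smul, mul_pow]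
      simp
      ring
    apply second_le (φ := fun t : ℝ => f (z + t • v) + ε * h (z + t • v))
      (φ1 := fun t : ℝ => pd v f (z + t • v) + ε * (Real.exp (-α * (‖z - y‖ ^ 2 + 2 * t * inner ℝ (z - y) v
        + t ^ 2 * ‖v‖ ^ 2)) * (-α * (2 * inner ℝ (z - y) v + 2 * t * ‖v‖ ^ 2))))
    · have hc : ContinuousAt (fun t : ℝ => z + t • v) 0 := by fun_prop
      have : IsLocalMax (fun x => f x + ε * h x) ((fun t : ℝ => z + t • v) 0) := by simpa using hlm
      exact hc.eventually this
    · filter_upwards [line_ne hz0 v] with t ht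
      simp only [hexp]
      exact (line_deriv hf z v ht).add ((barrier_deriv _ _ _ _ _ t).const_mul ε)
    · have h1 := line_deriv (pd_smooth (v := v) hf) z v (t := 0) (by simpa using hz0)
      simp only [zero_smul, add_zero] at h1
      exact h1.add ((barrier_deriv2 _ _ _ _).const_mul ε)
  obtain ⟨b, w, hw, hsum⟩ := hL z hz0
  set X := Real.exp (-α * ‖z - y‖ ^ 2) with hX
  have hX0 : 0 < X := Real.exp_pos _
  have hs1 : ∑ k, w k * (pd (b k) (pd (b k) f) z + ε * (X *
        (4 * α ^ 2 * (inner ℝ (z - y) (b k)) ^ 2 - 2 * α))) ≤ 0 := by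
    apply Finset.sum_nonpos
    intro k _
    have := key (b k)
    rw [b.norm_eq_one] at this
    apply mul_nonpos_of_nonneg_of_nonpos (hθ.le.trans (hw k).1)
    linarith
  have hs2 : ∑ k, w k * (pd (b k) (pd (b k) f) z + ε * (X *
        (4 * α ^ 2 * (inner ℝ (z - y) (b k)) ^ 2 - 2 * α))) =
      ∑ k, w k * pd (b k) (pd (b k) f) z + ε * X * ∑ k, w k * 
        (4 * α ^ 2 * (inner ℝ (z - y) (b k)) ^ 2 - 2 * α) := by
    rw [Finset.mul_sum, ← Finset.sum_add_distrib]
    refine Finset.sum_congr rfl fun k _ => by ring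
  have hs3 : ∑ k, (θ * (4 * α ^ 2 * (inner ℝ (z - y) (b k)) ^ 2) - 2 * α) ≤ ∑ k, w k * 
        (4 * α ^ 2 * (inner ℝ (z - y) (b k)) ^ 2 - 2 * α) := by
    apply Finset.sum_le_sum
    intro k _
    have h1 : 0 ≤ 4 * α ^ 2 * (inner ℝ (z - y) (b k)) ^ 2 := by positivity
    have h2 := mul_le_mul_of_nonneg_right (hw k).1 h1
    have h3 := mul_le_mul_of_nonneg_right (hw k).2 (show 0 ≤ 2 * α by positivity)
    linarith
  have hs4 : ∑ k, (inner ℝ (z - y) (b k)) ^ 2 = ‖z - y‖ ^ 2 := by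
    have := b.sum_sq_norm_inner_left (z - y)
    simpa using this
  have hs5 : ∑ k, (θ * (4 * α ^ 2 * (inner ℝ (z - y) (b k)) ^ 2) - 2 * α) =
      θ * (4 * α ^ 2) * ‖z - y‖ ^ 2 - 2 * α * n := by
    rw [← hs4, Finset.sum_sub_distrib, Finset.mul_sum]
    simp [mul_assoc, mul_comm]
  have hzy : (R / 2) ^ 2 ≤ ‖z - y‖ ^ 2 := by
    rw [← dist_eq_norm]
    have := hKy z hz
    gcongr
  have hs6 : 0 < θ * (4 * α ^ 2) * ‖z - y‖ ^ 2 - 2 * α * n := by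
    have h1 : θ * (4 * α ^ 2) * (R / 2) ^ 2 ≤ θ * (4 * α ^ 2) * ‖z - y‖ ^ 2 := by gcongr
    have h2 : θ * (4 * α ^ 2) * (R / 2) ^ 2 = α * (2 * n + 1) := by rw [← hα1]; ring
    nlinarith
  have := mul_pos (mul_pos hε0 hX0) (lt_of_lt_of_le (hs5 ▸ hs6) hs3)
  linarith

theorem strong_max {n : ℕ} (hn : 2 ≤ n) {f : EuclideanSpace ℝ (Fin n) → ℝ}
    (hf : ContDiffOn ℝ ∞ f {0}ᶜ) {θ : ℝ} (hθ : 0 < θ)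
    (hL : ∀ x, x ≠ 0 → ∃ (b : OrthonormalBasis (Fin n) ℝ (EuclideanSpace ℝ (Fin n)))
      (w : Fin n → ℝ), (∀ k, θ ≤ w k ∧ w k ≤ 1) ∧ 0 ≤ ∑ k, w k * pd (b k) (pd (b k) f) x)
    {M : ℝ} (hM : ∀ x, x ≠ 0 → f x ≤ M)
    {p : EuclideanSpace ℝ (Fin n)} (hp : p ≠ 0) (hfp : f p = M) :
    ∀ x, x ≠ 0 → f x = M := by
  have hfc : ContinuousOn f {0}ᶜ := hf.continuousOn
  have hopen : ∀ p, p ≠ 0 → f p = M → ∀ y, dist y p < ‖p‖ / 4 → f y = M := by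
    intro p hp hfp y hy
    have hpn : 0 < ‖p‖ := norm_pos_iff.mpr hp
    have hBne : ∀ x, dist x p ≤ ‖p‖ / 2 → x ≠ 0 := by
      rintro x hx rfl
      rw [dist_zero_left] at hx
      linarith
    by_contra hfy
    have hK : IsCompact (Metric.closedBall p (‖p‖ / 2) ∩ f ⁻¹' {M}) := by
      apply (isCompact_closedBall p (‖p‖ / 2)).of_isClosed_subset _ Set.inter_subset_left
      exact (hfc.mono (fun x hx => hBne x hx)).preimage_isClosed_of_isClosed
        Metric.isClosed_closedBall isClosed_singleton
    obtain ⟨x1, hx1, hmin⟩ := hK.exists_isMinOn (f := fun x => dist x y)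
      ⟨p, by simp; positivity, hfp⟩ (by fun_prop)
    have hmin' : ∀ x, dist x p ≤ ‖p‖ / 2 → f x = M → dist x1 y ≤ dist x y := by
      intro x h1 h2
      exact hmin (show x ∈ Metric.closedBall p (‖p‖ / 2) ∩ f ⁻¹' {M} from ⟨h1, h2⟩)
    have hx1f : f x1 = M := hx1.2
    have hRle : dist x1 y ≤ dist p y := hmin' p (by simp; positivity) hfp
    rw [dist_comm p y] at hRle
    have hR : 0 < dist x1 y := by
      rw [dist_pos]
      rintro rfl
      exact hfy hx1f
    have hmid1 : dist x1 (midpoint ℝ y x1) = dist x1 y / 2 := by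
      rw [dist_comm, dist_midpoint_right, dist_comm]; simp; ring
    have hmid2 : dist (midpoint ℝ y x1) y = dist x1 y / 2 := by
      rw [dist_midpoint_left, dist_comm]; simp; ring
    refine hopf hf hθ hL hM (hBne x1 hx1.1) hx1f (half_pos hR) hmid1 ?_
    intro x hx hxne
    have hxy : dist x y < dist x1 y := by
      have h1 : dist x y ≤ dist x1 y := by
        have := dist_triangle x (midpoint ℝ y x1) y
        linarith
      refine lt_of_le_of_ne h1 fun heq => hxne ?_
      have hp := parallelogram_law_with_norm ℝ (x - midpoint ℝ y x1) (midpoint ℝ y x1 - y)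
      rw [sub_add_sub_cancel, ← dist_eq_norm x y, ← dist_eq_norm x (midpoint ℝ y x1),
        ← dist_eq_norm _ y, hmid2, heq] at hp
      have h3 : ‖x - midpoint ℝ y x1 - (midpoint ℝ y x1 - y)‖ = 0 := by
        have h4 : dist x (midpoint ℝ y x1) * dist x (midpoint ℝ y x1) ≤
          (dist x1 y / 2) * (dist x1 y / 2) := by gcongr
        nlinarith [norm_nonneg (x - midpoint ℝ y x1 - (midpoint ℝ y x1 - y))]
      rw [norm_eq_zero] at h3
      have h5 : midpoint ℝ y x1 + midpoint ℝ y x1 = y + x1 := midpoint_add_self ℝ y x1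
      have h6 : x = midpoint ℝ y x1 + midpoint ℝ y x1 - y := by
        rw [sub_eq_zero] at h3
        rw [sub_eq_iff_eq_add] at h3
        rw [h3]; abel
      rw [h6, h5]; abel
    have hxp : dist x p ≤ ‖p‖ / 2 := by
      have := dist_triangle x y p
      linarith
    refine lt_of_le_of_ne (hM x (hBne x hxp)) fun heq => ?_
    have := hmin' x hxp heq
    linarith
  have hconn : IsPreconnected ({0}ᶜ : Set (EuclideanSpace ℝ (Fin n))) :=
    (isConnected_compl_singleton_of_one_lt_rank (by
      rw [← Module.finrank_eq_rank]; simp; omega) 0).isPreconnected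
  have hU : IsOpen {x : EuclideanSpace ℝ (Fin n) | x ≠ 0 ∧ f x = M} := by
    rw [Metric.isOpen_iff]
    rintro x ⟨hx, hfx⟩
    have hxn : 0 < ‖x‖ := norm_pos_iff.mpr hx
    refine ⟨‖x‖ / 4, by positivity, fun y hy => ⟨?_, hopen x hx hfx y hy⟩⟩
    rintro rfl
    rw [Metric.mem_ball, dist_zero_left] at hy
    linarith
  have hV : IsOpen ({0}ᶜ ∩ f ⁻¹' (Set.Iio M)) :=
    hfc.isOpen_inter_preimage isOpen_compl_singleton isOpen_Iio
  have := hconn.subset_left_of_subset_union hU hV ?_ ?_ ⟨p, hp, hp, hfp⟩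
  · exact fun x hx => (this hx).2
  · rw [Set.disjoint_left]
    rintro x ⟨_, h1⟩ ⟨_, h2⟩
    exact absurd h1 (ne_of_lt h2)
  · intro x hx
    rcases (hM x hx).lt_or_eq with h | h
    · exact Or.inr ⟨hx, h⟩
    · exact Or.inl ⟨hx, h⟩

theorem three_aux {a b c : ℝ} (hab : a ≤ b)
    (h1 : 0 ≤ 3 + a ^ 2 + 2 * a * c) (h2 : 0 ≤ 3 + b ^ 2 + 2 * b * c)
    (h3 : 0 ≤ 3 + c ^ 2 + 2 * c * a) (h4 : 0 ≤ 3 + c ^ 2 + 2 * c * b) (ha : 0 ≤ a) :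
    0 ≤ 3 + a * b + b * c + c * a := by
  rcases le_or_gt 0 c with hc | hc
  · have hb := ha.trans hab
    positivity
  · have hb := ha.trans hab
    obtain ⟨t, rfl⟩ : ∃ t, c = -t := ⟨-c, by ring⟩
    have ht : 0 < t := by linarith
    rcases le_or_gt t a with h | h
    · -- p = a - t, q = b - t ≥ p ≥ 0
      nlinarith [mul_nonneg (sub_nonneg.mpr h) (sub_nonneg.mpr hab)]
    · rcases le_or_gt b t with h' | h'
      · nlinarith [mul_nonneg (sub_nonneg.mpr h') (sub_nonneg.mpr hab)]
      · -- a < t < b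
        have hq : t * b ≤ 3 := by
          by_contra hcon
          push Not at hcon
          have : 3 < t ^ 2 := by nlinarith
          nlinarith
        nlinarith [mul_nonneg ha (sub_nonneg.mpr h'.le)]

theorem three_aux2 {a b c : ℝ}
    (h1 : 0 ≤ 3 + a ^ 2 + 2 * a * c) (h2 : 0 ≤ 3 + b ^ 2 + 2 * b * c)
    (h3 : 0 ≤ 3 + c ^ 2 + 2 * c * a) (h4 : 0 ≤ 3 + c ^ 2 + 2 * c * b) (h : 0 ≤ a * b) :
    0 ≤ 3 + a * b + b * c + c * a := by
  rcases le_total 0 a with ha | ha <;> rcases le_total 0 b with hb | hb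
  · rcases le_total a b with hab | hab
    · exact three_aux hab h1 h2 h3 h4 ha
    · linarith [three_aux hab h2 h1 h4 h3 hb]
  · have h0 : a * b = 0 := le_antisymm (mul_nonpos_of_nonneg_of_nonpos ha hb) h
    rcases mul_eq_zero.mp h0 with rfl | rfl
    · nlinarith [sq_nonneg (b + c)]
    · nlinarith [sq_nonneg (a + c)]
  · have h0 : a * b = 0 := le_antisymm (mul_nonpos_of_nonpos_of_nonneg ha hb) h
    rcases mul_eq_zero.mp h0 with rfl | rfl
    · nlinarith [sq_nonneg (b + c)]
    · nlinarith [sq_nonneg (a + c)]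
  · rcases le_total a b with hab | hab
    · have := three_aux (a := -b) (b := -a) (c := -c) (by linarith) (by linarith) (by linarith)
        (by linarith) (by linarith) (by linarith)
      linarith
    · have := three_aux (a := -a) (b := -b) (c := -c) (by linarith) (by linarith) (by linarith)
        (by linarith) (by linarith) (by linarith)
      linarith

theorem three_nonneg {n : ℕ} {l : Fin n → ℝ} (h : ∀ i j, 0 ≤ 3 + l i ^ 2 + 2 * l i * l j)
    (i j k : Fin n) : 0 ≤ 3 + l i * l j + l j * l k + l k * l i := by
  by_cases h1 : 0 ≤ l i * l j
  · exact three_aux2 (h _ _) (h _ _) (h _ _) (h _ _) h1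
  by_cases h2 : 0 ≤ l j * l k
  · linarith [three_aux2 (h j i) (h k i) (h i j) (h i k) h2]
  by_cases h3 : 0 ≤ l k * l i
  · linarith [three_aux2 (h k j) (h i j) (h j k) (h j i) h3]
  exfalso
  push Not at h1 h2 h3
  have := mul_pos_of_neg_of_neg h1 h2
  have h4 : l i * l j * (l j * l k) * (l k * l i) = (l i * l j * l k) ^ 2 := by ring
  nlinarith [sq_nonneg (l i * l j * l k)]

/-- The algebraic heart of the Jacobi inequality. `T a b k` are third derivatives, `Q a k` are the
fourth derivatives `u_{aakk}`. -/
theorem jacobi_alg {n : ℕ} {l g F : Fin n → ℝ} {T : Fin n → Fin n → Fin n → ℝ}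
    {Q : Fin n → Fin n → ℝ}
    (hT1 : ∀ a b k, T a b k = T b a k) (hT2 : ∀ a b k, T a b k = T a k b)
    (hQ : ∀ a k, Q a k = Q k a)
    (hre : ∀ k, F k = ∑ a, l a * g a * Q a k + ∑ a, ∑ b, g a * g b * (1 - l a * l b) * T a b k ^ 2)
    (him : ∀ k, 0 = ∑ a, g a * Q a k - ∑ a, ∑ b, g a * g b * (l a + l b) * T a b k ^ 2) :
    3 * ∑ k, g k * F k = ∑ a, ∑ b, ∑ k, (3 + l a * l b + l b * l k + l k * l a) *
      (g a * g b * g k * T a b k ^ 2) := by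
  have e1 : ∑ k, g k * F k = ∑ k, ∑ a, g k * (l a * g a * Q a k) +
      ∑ k, ∑ a, ∑ b, g k * (g a * g b * (1 - l a * l b) * T a b k ^ 2) := by
    rw [← Finset.sum_add_distrib]
    refine Finset.sum_congr rfl fun k _ => ?_
    rw [hre k, mul_add]
    simp only [Finset.mul_sum]
  have e2 : ∑ k, ∑ a, g k * (l a * g a * Q a k) =
      ∑ k, ∑ a, ∑ b, l k * g k * (g a * g b * (l a + l b) * T a b k ^ 2) := by
    rw [Finset.sum_comm]
    refine Finset.sum_congr rfl fun k _ => ?_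
    have : ∑ a, g a * Q a k = ∑ a, ∑ b, g a * g b * (l a + l b) * T a b k ^ 2 := by
      linarith [him k]
    simp only [← Finset.mul_sum]
    rw [← this, Finset.mul_sum]
    refine Finset.sum_congr rfl fun a _ => ?_
    rw [hQ k a]; ring
  set P : Fin n → Fin n → Fin n → ℝ := fun a b k =>
    (1 - l a * l b + l k * l a + l k * l b) * (g a * g b * g k * T a b k ^ 2) with hP
  have e3 : ∑ k, g k * F k = ∑ k, ∑ a, ∑ b, P a b k := by
    rw [e1, e2]
    simp only [← Finset.sum_add_distrib]
    refine Finset.sum_congr rfl fun k _ => Finset.sum_congr rfl fun a _ =>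
      Finset.sum_congr rfl fun b _ => ?_
    simp only [hP]; ring
  have f1 : ∑ k, g k * F k = ∑ a, ∑ b, ∑ k, P a b k := by
    rw [e3, Finset.sum_comm]
    refine Finset.sum_congr rfl fun a _ => ?_
    rw [Finset.sum_comm]
  have f2 : ∑ k, g k * F k = ∑ a, ∑ b, ∑ k, P k a b := by
    rw [f1]
    rw [Finset.sum_comm]
    have : ∀ b : Fin n, ∑ a, ∑ k, P a b k = ∑ k, ∑ a, P a b k := fun b => Finset.sum_comm
    simp only [this]
  have f3 : ∑ k, g k * F k = ∑ a, ∑ b, ∑ k, P b k a := by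
    rw [e3]
  have : 3 * ∑ k, g k * F k = ∑ a, ∑ b, ∑ k, P a b k + ∑ a, ∑ b, ∑ k, P k a b +
      ∑ a, ∑ b, ∑ k, P b k a := by
    rw [← f1, ← f2, ← f3]; ring
  rw [this]
  simp only [← Finset.sum_add_distrib]
  refine Finset.sum_congr rfl fun a _ => Finset.sum_congr rfl fun b _ =>
      Finset.sum_congr rfl fun k _ => ?_
  have t1 : T k a b = T a b k := by rw [hT1 k a b, hT2 a k b]
  have t2 : T b k a = T a b k := by rw [hT2 b k a, hT1 b a k]
  simp only [hP, t1, t2]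
  ring

theorem lap_alg {n : ℕ} {l g : Fin n → ℝ} {τ : Fin n → ℝ} (m : ℝ)
    (hg : ∀ a, g a * (1 + l a ^ 2) = 1)
    (h1 : ∑ a, g a * τ a = 0) (h2 : ∑ a, l a * g a * τ a = 0)
    (h3 : ∀ a, (3 + l a ^ 2 + 2 * l a * m) * τ a = 0) : ∑ a, τ a = 0 := by
  have : ∑ a, τ a = -2 * ∑ a, g a * τ a - 2 * m * ∑ a, l a * g a * τ a := by
    rw [Finset.mul_sum, Finset.mul_sum, ← Finset.sum_sub_distrib]
    refine Finset.sum_congr rfl fun a _ => ?_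
    linear_combination (-τ a) * hg a + g a * h3 a
  rw [this, h1, h2]; ring

theorem det_deriv {n : ℕ} {A : ℝ → Matrix (Fin n) (Fin n) ℂ} {A' : Matrix (Fin n) (Fin n) ℂ}
    {t : ℝ} (h : ∀ i j, HasDerivAt (fun s => A s i j) (A' i j) t) :
    HasDerivAt (fun s => (A s).det) (((A t).adjugate * A').trace) t := by
  have h1 : ((A t).adjugate * A').trace = ∑ σ : Equiv.Perm (Fin n),
      ((Equiv.Perm.sign σ : ℤ) : ℂ) * ∑ i, (∏ j ∈ Finset.univ.erase i, A t (σ j) j) • A' (σ i) i := by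
    simp only [Finset.mul_sum]
    rw [Finset.sum_comm, Matrix.trace]
    refine Finset.sum_congr rfl fun i _ => ?_
    have : ((A t).adjugate * A').diag i = ((A t).updateCol i (fun j => A' j i)).det := by
      rw [← Matrix.cramer_apply, Matrix.cramer_eq_adjugate_mulVec]
      rfl
    rw [this, Matrix.det_apply']
    refine Finset.sum_congr rfl fun σ _ => ?_
    congr 1
    rw [← Finset.prod_erase_mul _ _ (Finset.mem_univ i)]
    simp only [Matrix.updateCol_self, smul_eq_mul]
    congr 1
    refine Finset.prod_congr rfl fun j hj => ?_
    rw [Matrix.updateCol_ne (Finset.ne_of_mem_erase hj)]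
  rw [h1]
  simp only [Matrix.det_apply']
  refine HasDerivAt.fun_sum fun σ _ => ?_
  exact (HasDerivAt.fun_finsetProd fun i _ => h (σ i) i).const_mul _

section
attribute [local instance] Matrix.linftyOpNormedRing Matrix.linftyOpNormedAlgebra

theorem inv_deriv {n : ℕ} {A : ℝ → Matrix (Fin n) (Fin n) ℂ} {A' : Matrix (Fin n) (Fin n) ℂ}
    {t : ℝ} (h : ∀ i j, HasDerivAt (fun s => A s i j) (A' i j) t) (hdet : (A t).det ≠ 0)
    (i j : Fin n) :
    HasDerivAt (fun s => (A s)⁻¹ i j) ((-((A t)⁻¹ * A' * (A t)⁻¹)) i j) t := by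
  have h1 : HasDerivAt A A' t := hasDerivAt_pi.2 fun i => hasDerivAt_pi.2 (h i)
  have hu : IsUnit (A t) := by
    rw [Matrix.isUnit_iff_isUnit_det]
    exact hdet.isUnit
  obtain ⟨U, hU⟩ := hu
  have h2 := hasFDerivAt_ringInverse (𝕜 := ℝ) U
  rw [hU] at h2
  have h3 := h2.comp_hasDerivAt t h1
  have h4 : HasDerivAt (fun s => (A s)⁻¹) (-((A t)⁻¹ * A' * (A t)⁻¹)) t := by
    have e : (fun s => (A s)⁻¹) = Ring.inverse ∘ A := by
      funext s
      simp [Matrix.nonsing_inv_eq_ringInverse]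
    rw [e]
    refine HasDerivAt.congr_deriv h3 ?_
    have hUi : ((U⁻¹ : (Matrix (Fin n) (Fin n) ℂ)ˣ) : Matrix (Fin n) (Fin n) ℂ) = (A t)⁻¹ := by
      rw [Matrix.coe_units_inv, hU]
    simp [hUi]
  exact hasDerivAt_pi.1 (hasDerivAt_pi.1 h4 i) j
end

theorem log_det_deriv {n : ℕ} {A A1 : ℝ → Matrix (Fin n) (Fin n) ℂ} {A2 : Matrix (Fin n) (Fin n) ℂ}
    {φ φ1 : ℝ → ℝ} {φ2 : ℝ} {z : ℂ} (hz : z ≠ 0)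
    (h1 : ∀ᶠ t in nhds 0, ∀ i j, HasDerivAt (fun s => A s i j) (A1 t i j) t)
    (h2 : ∀ i j, HasDerivAt (fun s => A1 s i j) (A2 i j) 0)
    (hφ1 : ∀ᶠ t in nhds 0, HasDerivAt φ (φ1 t) t) (hφ2 : HasDerivAt φ1 φ2 0)
    (hdet : ∀ᶠ t in nhds 0, (A t).det = (Real.exp (φ t) : ℂ) * z) :
    (φ1 0 : ℂ) = ((A 0)⁻¹ * A1 0).trace ∧
    (φ2 : ℂ) = ((A 0)⁻¹ * A2).trace - ((A 0)⁻¹ * A1 0 * (A 0)⁻¹ * A1 0).trace := by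
  have e1 : ∀ᶠ t in nhds 0, (φ1 t : ℂ) = ((A t)⁻¹ * A1 t).trace := by
    filter_upwards [h1, hφ1, hdet, hdet.eventually_nhds] with t ha hb hc hc'
    have hd := det_deriv ha
    have he : HasDerivAt (fun s => (A s).det) ((Real.exp (φ t) * φ1 t : ℝ) * z) t :=
      ((hb.exp).ofReal_comp.mul_const z).congr_of_eventuallyEq hc'
    have hf := hd.unique he
    have hne : (A t).det ≠ 0 := by
      rw [hc]
      exact mul_ne_zero (by exact_mod_cast (Real.exp_pos _).ne') hz
    rw [Matrix.inv_def, Ring.inverse_eq_inv', Matrix.smul_mul, Matrix.trace_smul, hf, smul_eq_mul,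
      eq_inv_mul_iff_mul_eq₀ hne, hc]
    push_cast
    ring
  refine ⟨e1.self_of_nhds, ?_⟩
  have hne : (A 0).det ≠ 0 := by
    rw [hdet.self_of_nhds]
    exact mul_ne_zero (by exact_mod_cast (Real.exp_pos _).ne') hz
  have d1 : HasDerivAt (fun t => (φ1 t : ℂ)) (φ2 : ℂ) 0 := hφ2.ofReal_comp
  have d2 : HasDerivAt (fun t => ((A t)⁻¹ * A1 t).trace)
      (∑ i, ∑ j, ((-((A 0)⁻¹ * A1 0 * (A 0)⁻¹)) i j * A1 0 j i + (A 0)⁻¹ i j * A2 j i)) 0 := by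
    have e : (fun t => ((A t)⁻¹ * A1 t).trace) = fun t => ∑ i, ∑ j, (A t)⁻¹ i j * A1 t j i := by
      funext t
      simp only [Matrix.trace, Matrix.diag, Matrix.mul_apply]
    rw [e]
    refine HasDerivAt.fun_sum fun i _ => HasDerivAt.fun_sum fun j _ => ?_
    exact (inv_deriv h1.self_of_nhds hne i j).mul (h2 j i)
  rw [d1.unique (d2.congr_of_eventuallyEq e1)]
  simp only [Finset.sum_add_distrib, Matrix.trace, Matrix.diag, Matrix.mul_apply, Matrix.neg_apply,
    neg_mul, Finset.sum_neg_distrib]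
  ring

theorem log_det_diag {n : ℕ} {A A1 : ℝ → Matrix (Fin n) (Fin n) ℝ} {A2 : Matrix (Fin n) (Fin n) ℝ}
    {φ φ1 : ℝ → ℝ} {φ2 : ℝ} {z : ℂ} (hz : z ≠ 0) {l g : Fin n → ℝ}
    (hg : ∀ a, g a * (1 + l a ^ 2) = 1) (hA : A 0 = Matrix.diagonal l)
    (h1 : ∀ᶠ t in nhds 0, ∀ i j, HasDerivAt (fun s => A s i j) (A1 t i j) t)
    (h2 : ∀ i j, HasDerivAt (fun s => A1 s i j) (A2 i j) 0)
    (hφ1 : ∀ᶠ t in nhds 0, HasDerivAt φ (φ1 t) t) (hφ2 : HasDerivAt φ1 φ2 0)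
    (hdet : ∀ᶠ t in nhds 0, (1 + Complex.I • (A t).map Complex.ofReal).det =
      (Real.exp (φ t) : ℂ) * z) :
    (φ1 0 = ∑ a, l a * g a * A1 0 a a ∧ 0 = ∑ a, g a * A1 0 a a) ∧
    φ2 = ∑ a, l a * g a * A2 a a +
      ∑ a, ∑ b, g a * g b * (1 - l a * l b) * (A1 0 a b * A1 0 b a) ∧
    0 = ∑ a, g a * A2 a a - ∑ a, ∑ b, g a * g b * (l a + l b) * (A1 0 a b * A1 0 b a) := by
  have key := log_det_deriv (A := fun t => 1 + Complex.I • (A t).map Complex.ofReal)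
    (A1 := fun t => Complex.I • (A1 t).map Complex.ofReal)
    (A2 := Complex.I • A2.map Complex.ofReal) hz ?_ ?_ hφ1 hφ2 hdet
  · set G : Fin n → ℂ := fun a => (g a : ℂ) * (1 - Complex.I * l a) with hG
    have hinv : (1 + Complex.I • (A 0).map Complex.ofReal)⁻¹ = Matrix.diagonal G := by
      apply Matrix.inv_eq_left_inv
      rw [hA]
      ext i j
      rw [Matrix.diagonal_mul]
      by_cases hij : i = j
      · subst hij
        simp only [Matrix.add_apply, Matrix.smul_apply, Matrix.map_apply, Matrix.diagonal_apply_eq,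
          Matrix.one_apply_eq, smul_eq_mul, hG]
        have := hg i
        have h' : (g i : ℂ) * (1 + (l i : ℂ) ^ 2) = 1 := by exact_mod_cast this
        linear_combination h' - (g i : ℂ) * (l i : ℂ) ^ 2 * Complex.I_sq
      · simp [hij]
    simp only [hinv] at key
    obtain ⟨k1, k2⟩ := key
    have k1' : (φ1 0 : ℂ) = ∑ a, (g a : ℂ) * (1 - Complex.I * l a) * (Complex.I * A1 0 a a) := by
      rw [k1]
      simp only [Matrix.trace, Matrix.diag, Matrix.diagonal_mul, hG, Matrix.smul_apply,
        Matrix.map_apply, smul_eq_mul]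
    have k2' : (φ2 : ℂ) = ∑ a, (g a : ℂ) * (1 - Complex.I * l a) * (Complex.I * A2 a a) -
       ∑ a, ∑ b, (g a : ℂ) * (1 - Complex.I * l a) * (Complex.I * A1 0 a b) *
        ((g b : ℂ) * (1 - Complex.I * l b)) * (Complex.I * A1 0 b a) := by
      rw [k2]
      congr 1
      · simp only [Matrix.trace, Matrix.diag, Matrix.diagonal_mul, hG, Matrix.smul_apply,
          Matrix.map_apply, smul_eq_mul]
      · simp only [Matrix.trace, Matrix.diag]
        refine Finset.sum_congr rfl fun a _ => ?_
        rw [Matrix.mul_apply]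
        refine Finset.sum_congr rfl fun b _ => ?_
        rw [Matrix.mul_diagonal, Matrix.diagonal_mul]
        simp [hG]
    refine ⟨⟨?_, ?_⟩, ?_, ?_⟩
    · have := congrArg Complex.re k1'
      simp only [Complex.ofReal_re, Complex.re_sum] at this
      refine this.trans ?_
      refine Finset.sum_congr rfl fun a _ => ?_
      simp only [Complex.mul_re, Complex.mul_im, Complex.sub_re, Complex.sub_im, Complex.one_re,
        Complex.one_im, Complex.I_re, Complex.I_im, Complex.ofReal_re, Complex.ofReal_im]
      ring
    · have := congrArg Complex.im k1'
      simp only [Complex.ofReal_im, Complex.im_sum] at this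
      refine this.trans ?_
      refine Finset.sum_congr rfl fun a _ => ?_
      simp only [Complex.mul_re, Complex.mul_im, Complex.sub_re, Complex.sub_im, Complex.one_re,
        Complex.one_im, Complex.I_re, Complex.I_im, Complex.ofReal_re, Complex.ofReal_im]
      ring
    · have := congrArg Complex.re k2'
      simp only [Complex.ofReal_re, Complex.re_sum, Complex.sub_re] at this
      refine this.trans ?_
      rw [sub_eq_add_neg, ← Finset.sum_neg_distrib]
      simp only [← Finset.sum_neg_distrib]
      congr 1
      · refine Finset.sum_congr rfl fun a _ => ?_
        simp only [Complex.mul_re, Complex.mul_im, Complex.sub_re, Complex.sub_im, Complex.one_re,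
          Complex.one_im, Complex.I_re, Complex.I_im, Complex.ofReal_re, Complex.ofReal_im]
        ring
      · refine Finset.sum_congr rfl fun a _ => Finset.sum_congr rfl fun b _ => ?_
        simp only [Complex.mul_re, Complex.mul_im, Complex.sub_re, Complex.sub_im, Complex.one_re,
          Complex.one_im, Complex.I_re, Complex.I_im, Complex.ofReal_re, Complex.ofReal_im]
        ring
    · have := congrArg Complex.im k2'
      simp only [Complex.ofReal_im, Complex.im_sum, Complex.sub_im] at this
      refine this.trans ?_
      congr 1
      · refine Finset.sum_congr rfl fun a _ => ?_
        simp only [Complex.mul_re, Complex.mul_im, Complex.sub_re, Complex.sub_im, Complex.one_re,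
          Complex.one_im, Complex.I_re, Complex.I_im, Complex.ofReal_re, Complex.ofReal_im]
        ring
      · refine Finset.sum_congr rfl fun a _ => Finset.sum_congr rfl fun b _ => ?_
        simp only [Complex.mul_re, Complex.mul_im, Complex.sub_re, Complex.sub_im, Complex.one_re,
          Complex.one_im, Complex.I_re, Complex.I_im, Complex.ofReal_re, Complex.ofReal_im]
        ring
  · filter_upwards [h1] with t ht i j
    simp only [Matrix.add_apply, Matrix.smul_apply, Matrix.map_apply, smul_eq_mul]
    exact ((ht i j).ofReal_comp.const_mul Complex.I).const_add _
  · intro i j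
    simp only [Matrix.smul_apply, Matrix.map_apply, smul_eq_mul]
    exact ((h2 i j).ofReal_comp.const_mul Complex.I)

theorem Hess_apply {n : ℕ} {u : EuclideanSpace ℝ (Fin n) → ℝ} (hu : ContDiffOn ℝ ∞ u {0}ᶜ)
    {x : EuclideanSpace ℝ (Fin n)} (hx : x ≠ 0) (i j : Fin n) :
    Hess u x i j = pd (EuclideanSpace.single i 1) (pd (EuclideanSpace.single j 1) u) x := by
  rw [pd_pd_eq hu hx, Hess, Matrix.of_apply, iteratedFDeriv_two_apply]
  simp

/-- Hessian in an arbitrary orthonormal basis. -/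
noncomputable def HessB {n : ℕ} (u : EuclideanSpace ℝ (Fin n) → ℝ)
    (b : OrthonormalBasis (Fin n) ℝ (EuclideanSpace ℝ (Fin n)))
    (x : EuclideanSpace ℝ (Fin n)) : Matrix (Fin n) (Fin n) ℝ :=
  Matrix.of fun i j => pd (b i) (pd (b j) u) x

/-- Matrix with columns the basis vectors. -/
noncomputable def bMat {n : ℕ} (b : OrthonormalBasis (Fin n) ℝ (EuclideanSpace ℝ (Fin n))) :
    Matrix (Fin n) (Fin n) ℝ := Matrix.of fun i a => b a i

theorem bMat_mul {n : ℕ} (b : OrthonormalBasis (Fin n) ℝ (EuclideanSpace ℝ (Fin n))) :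
    (bMat b).transpose * bMat b = 1 := by
  ext i j
  rw [Matrix.mul_apply, Matrix.one_apply]
  have := orthonormal_iff_ite.mp b.orthonormal j i
  rw [PiLp.inner_apply] at this
  simp only [Matrix.transpose_apply, bMat, Matrix.of_apply]
  simp only [eq_comm (a := i)]
  rw [← this]
  simp

theorem HessB_eq {n : ℕ} {u : EuclideanSpace ℝ (Fin n) → ℝ} (hu : ContDiffOn ℝ ∞ u {0}ᶜ)
    (b : OrthonormalBasis (Fin n) ℝ (EuclideanSpace ℝ (Fin n)))
    {x : EuclideanSpace ℝ (Fin n)} (hx : x ≠ 0) :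
    HessB u b x = (bMat b).transpose * Hess u x * bMat b := by
  ext a c
  have hexp : ∀ v : EuclideanSpace ℝ (Fin n), v = ∑ i, v i • EuclideanSpace.single i (1 : ℝ) := by
    intro v
    ext j
    simp [Finset.sum_apply, Pi.single_apply]
  simp only [HessB, Matrix.of_apply, Matrix.mul_apply, Matrix.transpose_apply, bMat]
  rw [pd_pd_eq hu hx]
  conv_lhs => rw [hexp (b a), hexp (b c)]
  simp only [map_sum, map_smul, sum_apply, smul_apply,
    ← pd_pd_eq hu hx, ← Hess_apply hu hx, smul_eq_mul, Finset.sum_mul, Finset.mul_sum]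
  refine Finset.sum_congr rfl fun i _ => Finset.sum_congr rfl fun j _ => by ring

theorem HessB_trace {n : ℕ} {u : EuclideanSpace ℝ (Fin n) → ℝ} (hu : ContDiffOn ℝ ∞ u {0}ᶜ)
    (b : OrthonormalBasis (Fin n) ℝ (EuclideanSpace ℝ (Fin n)))
    {x : EuclideanSpace ℝ (Fin n)} (hx : x ≠ 0) :
    (HessB u b x).trace = (Hess u x).trace := by
  rw [HessB_eq hu b hx, Matrix.mul_assoc, Matrix.trace_mul_comm, Matrix.mul_assoc,
    mul_eq_one_comm.mp (bMat_mul b), Matrix.mul_one]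

theorem det_conj {n : ℕ} {P H : Matrix (Fin n) (Fin n) ℝ} (hP : P.transpose * P = 1) :
    (1 + Complex.I • (P.transpose * H * P).map Complex.ofReal).det =
      (1 + Complex.I • H.map Complex.ofReal).det := by
  have h1 : (P.transpose.map Complex.ofReal) * (P.map Complex.ofReal) = 1 := by
    have := congrArg (fun M : Matrix (Fin n) (Fin n) ℝ => M.map Complex.ofRealHom) hP
    simp only [Matrix.map_mul] at this
    rw [Matrix.map_one _ (map_zero _) (map_one _)] at this
    exact this
  have h2 : (P.transpose * H * P).map Complex.ofReal =
      (P.transpose.map Complex.ofReal) * (H.map Complex.ofReal) * (P.map Complex.ofReal) := by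
    have : ∀ X Y : Matrix (Fin n) (Fin n) ℝ, (X * Y).map Complex.ofReal =
        X.map Complex.ofReal * Y.map Complex.ofReal := fun X Y =>
      Matrix.map_mul (f := Complex.ofRealHom)
    rw [this, this]
  have h3 : 1 + Complex.I • (P.transpose * H * P).map Complex.ofReal =
      (P.transpose.map Complex.ofReal) * (1 + Complex.I • H.map Complex.ofReal) *
        (P.map Complex.ofReal) := by
    rw [h2, Matrix.mul_add, Matrix.add_mul, Matrix.mul_one, h1, Matrix.mul_smul, Matrix.smul_mul]
  rw [h3, Matrix.det_mul, Matrix.det_mul, mul_right_comm, ← Matrix.det_mul, h1, Matrix.det_one,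
    one_mul]

theorem HessB_eigen {n : ℕ} {u : EuclideanSpace ℝ (Fin n) → ℝ} (hu : ContDiffOn ℝ ∞ u {0}ᶜ)
    {x : EuclideanSpace ℝ (Fin n)} (hx : x ≠ 0) (hH : (Hess u x).IsHermitian) :
    HessB u hH.eigenvectorBasis x = Matrix.diagonal hH.eigenvalues := by
  rw [HessB_eq hu _ hx]
  have h1 : Hess u x * bMat hH.eigenvectorBasis =
      bMat hH.eigenvectorBasis * Matrix.diagonal hH.eigenvalues := by
    ext i a
    have := congrFun (hH.mulVec_eigenvectorBasis a) i
    rw [Matrix.mul_diagonal]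
    simp only [Matrix.mulVec, dotProduct, Pi.smul_apply, smul_eq_mul] at this
    simp only [Matrix.mul_apply, bMat, Matrix.of_apply]
    rw [mul_comm]
    exact this
  rw [Matrix.mul_assoc, h1, ← Matrix.mul_assoc, bMat_mul, Matrix.one_mul]

/-- The complex determinant. -/
noncomputable def cdet {n : ℕ} (u : EuclideanSpace ℝ (Fin n) → ℝ) (x : EuclideanSpace ℝ (Fin n)) : ℂ :=
  (1 + Complex.I • (Hess u x).map Complex.ofReal).det

theorem cdet_basis {n : ℕ} {u : EuclideanSpace ℝ (Fin n) → ℝ} (hu : ContDiffOn ℝ ∞ u {0}ᶜ)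
    (b : OrthonormalBasis (Fin n) ℝ (EuclideanSpace ℝ (Fin n)))
    {x : EuclideanSpace ℝ (Fin n)} (hx : x ≠ 0) :
    (1 + Complex.I • (HessB u b x).map Complex.ofReal).det = cdet u x := by
  rw [HessB_eq hu b hx, det_conj (bMat_mul b), cdet]

theorem cdet_prod {n : ℕ} {u : EuclideanSpace ℝ (Fin n) → ℝ} (hu : ContDiffOn ℝ ∞ u {0}ᶜ)
    {x : EuclideanSpace ℝ (Fin n)} (hx : x ≠ 0) (hH : (Hess u x).IsHermitian) :
    cdet u x = ∏ i, (1 + Complex.I * hH.eigenvalues i) := by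
  rw [← cdet_basis hu hH.eigenvectorBasis hx, HessB_eigen hu hx]
  have : 1 + Complex.I • (Matrix.diagonal hH.eigenvalues).map Complex.ofReal =
      Matrix.diagonal fun i => 1 + Complex.I * (hH.eigenvalues i : ℂ) := by
    ext i j
    by_cases hij : i = j
    · subst hij; simp
    · simp [hij]
  rw [this, Matrix.det_diagonal]

theorem one_add_I (l : ℝ) : (1 + Complex.I * l : ℂ) =
    (Real.sqrt (1 + l ^ 2) : ℂ) * Complex.exp (Complex.I * Real.arctan l) := by
  have hs : Real.sqrt (1 + l ^ 2) ≠ 0 := by positivity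
  rw [mul_comm Complex.I (Real.arctan l : ℂ), Complex.exp_mul_I, ← Complex.ofReal_cos,
    ← Complex.ofReal_sin, Real.cos_arctan, Real.sin_arctan]
  have hs' : (Real.sqrt (1 + l ^ 2) : ℂ) ≠ 0 := by exact_mod_cast hs
  push_cast
  field_simp

/-- The logarithm of the volume element. -/
noncomputable def lvol {n : ℕ} (u : EuclideanSpace ℝ (Fin n) → ℝ) (x : EuclideanSpace ℝ (Fin n)) : ℝ :=
  Real.log ‖cdet u x‖

theorem cdet_norm {n : ℕ} {u : EuclideanSpace ℝ (Fin n) → ℝ} (hu : ContDiffOn ℝ ∞ u {0}ᶜ)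
    {x : EuclideanSpace ℝ (Fin n)} (hx : x ≠ 0) (hH : (Hess u x).IsHermitian) :
    ‖cdet u x‖ = ∏ i, Real.sqrt (1 + hH.eigenvalues i ^ 2) := by
  rw [cdet_prod hu hx hH, norm_prod]
  refine Finset.prod_congr rfl fun i _ => ?_
  rw [one_add_I, norm_mul, mul_comm Complex.I, Complex.norm_exp_ofReal_mul_I, mul_one,
    Complex.norm_real, Real.norm_of_nonneg (Real.sqrt_nonneg _)]

theorem exp_lvol {n : ℕ} {u : EuclideanSpace ℝ (Fin n) → ℝ} (hu : ContDiffOn ℝ ∞ u {0}ᶜ)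
    {x : EuclideanSpace ℝ (Fin n)} (hx : x ≠ 0) (hH : (Hess u x).IsHermitian) :
    Real.exp (lvol u x) = ‖cdet u x‖ := by
  rw [lvol, Real.exp_log]
  rw [cdet_norm hu hx hH]
  exact Finset.prod_pos fun i _ => by positivity

theorem cdet_eq {n : ℕ} {u : EuclideanSpace ℝ (Fin n) → ℝ} (hu : ContDiffOn ℝ ∞ u {0}ᶜ)
    {x : EuclideanSpace ℝ (Fin n)} (hx : x ≠ 0) (hH : (Hess u x).IsHermitian) {c : ℝ}
    (hc : ∑ i, Real.arctan (hH.eigenvalues i) = c) :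
    cdet u x = (Real.exp (lvol u x) : ℂ) * Complex.exp (Complex.I * c) := by
  rw [exp_lvol hu hx hH, cdet_norm hu hx hH, cdet_prod hu hx hH]
  simp only [one_add_I]
  rw [Finset.prod_mul_distrib, ← Complex.exp_sum, ← Finset.mul_sum, ← hc]
  push_cast
  rfl

theorem eig_le {n : ℕ} {u : EuclideanSpace ℝ (Fin n) → ℝ} (hu : ContDiffOn ℝ ∞ u {0}ᶜ)
    {x : EuclideanSpace ℝ (Fin n)} (hx : x ≠ 0) (hH : (Hess u x).IsHermitian) (k : Fin n) :
    1 + hH.eigenvalues k ^ 2 ≤ Real.exp (lvol u x) ^ 2 := by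
  rw [exp_lvol hu hx hH, cdet_norm hu hx hH, ← Finset.prod_pow]
  have : ∀ i, Real.sqrt (1 + hH.eigenvalues i ^ 2) ^ 2 = 1 + hH.eigenvalues i ^ 2 := fun i =>
    Real.sq_sqrt (by positivity)
  simp only [this]
  rw [← Finset.mul_prod_erase _ _ (Finset.mem_univ k)]
  apply le_mul_of_one_le_right (by positivity)
  have h1 : ∏ i ∈ Finset.univ.erase k, (1 : ℝ) ≤
      ∏ i ∈ Finset.univ.erase k, (1 + hH.eigenvalues i ^ 2) := by
    refine Finset.prod_le_prod (fun i _ => zero_le_one) fun i _ => ?_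
    have := sq_nonneg (hH.eigenvalues i)
    linarith
  simpa using h1

theorem lvol_smooth {n : ℕ} {u : EuclideanSpace ℝ (Fin n) → ℝ} (hu : ContDiffOn ℝ ∞ u {0}ᶜ)
    (hsym : ∀ x : EuclideanSpace ℝ (Fin n), x ≠ 0 → (Hess u x).IsHermitian) {c : ℝ}
    (hsol : ∀ (x : EuclideanSpace ℝ (Fin n)) (hx : x ≠ 0),
      ∑ i, Real.arctan ((hsym x hx).eigenvalues i) = c) :
    ContDiffOn ℝ ∞ (lvol u) {0}ᶜ := by
  have hH : ∀ i j, ContDiffOn ℝ ∞ (fun x => Hess u x i j) {0}ᶜ := fun i j =>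
    (pd_smooth (pd_smooth hu)).congr fun x hx => Hess_apply hu hx i j
  have hC : ContDiffOn ℝ ∞ (cdet u) {0}ᶜ := by
    unfold cdet
    simp only [Matrix.det_apply']
    refine ContDiffOn.sum fun σ _ => contDiffOn_const.mul ?_
    refine contDiffOn_prod fun i _ => ?_
    simp only [Matrix.add_apply, Matrix.smul_apply, Matrix.map_apply, smul_eq_mul]
    refine contDiffOn_const.add (contDiffOn_const.mul ?_)
    exact Complex.ofRealCLM.contDiff.comp_contDiffOn (hH _ _)
  have hR : ContDiffOn ℝ ∞ (fun x => (cdet u x * Complex.exp (-(Complex.I * c))).re) {0}ᶜ :=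
    Complex.reCLM.contDiff.comp_contDiffOn (hC.mul contDiffOn_const)
  have hE : ∀ x : EuclideanSpace ℝ (Fin n), x ≠ 0 →
      (cdet u x * Complex.exp (-(Complex.I * c))).re = Real.exp (lvol u x) := by
    intro x hx
    rw [cdet_eq hu hx (hsym x hx) (hsol x hx), mul_assoc, ← Complex.exp_add]
    simp only [add_neg_cancel, Complex.exp_zero, mul_one, Complex.ofReal_re]
  refine (hR.log fun x hx => ?_).congr fun x hx => ?_
  · rw [hE x hx]; exact (Real.exp_pos _).ne'
  · rw [hE x hx, Real.log_exp]

theorem pd_hom {n : ℕ} {g : EuclideanSpace ℝ (Fin n) → ℝ} (hg : ContDiffOn ℝ ∞ g {0}ᶜ) {t : ℝ}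
    (ht : 0 < t) {k : ℕ} (h : ∀ x, x ≠ 0 → g (t • x) = t ^ (k + 1) * g x)
    (v : EuclideanSpace ℝ (Fin n)) : ∀ x, x ≠ 0 → pd v g (t • x) = t ^ k * pd v g x := by
  intro x hx
  have h1 : pd v (fun y => g (t • y)) x = pd v (fun y => t ^ (k + 1) * g y) x :=
    pd_congr h hx
  have h2 : pd v (fun y => g (t • y)) x = t * pd v g (t • x) := by
    unfold pd
    have := fderiv_comp_smul (𝕜 := ℝ) (f := g) (x := x) t
    rw [this]
    simp
  have h3 : pd v (fun y => t ^ (k + 1) * g y) x = t ^ (k + 1) * pd v g x := by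
    unfold pd
    rw [fderiv_const_mul (smooth_diffAt hg hx)]
    simp
  rw [h2, h3, pow_succ] at h1
  apply mul_left_cancel₀ ht.ne'
  rw [h1]; ring

theorem Hess_hom {n : ℕ} {u : EuclideanSpace ℝ (Fin n) → ℝ} (hu : ContDiffOn ℝ ∞ u {0}ᶜ)
    (hhom : ∀ x : EuclideanSpace ℝ (Fin n), x ≠ 0 → u x = ‖x‖ ^ 2 * u (‖x‖⁻¹ • x)) {t : ℝ}
    (ht : 0 < t) {x : EuclideanSpace ℝ (Fin n)} (hx : x ≠ 0) : Hess u (t • x) = Hess u x := by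
  have h0 : ∀ x, x ≠ 0 → u (t • x) = t ^ (1 + 1) * u x := by
    intro x hx
    have hxn : ‖x‖ ≠ 0 := norm_ne_zero_iff.mpr hx
    rw [hhom (t • x) (smul_ne_zero ht.ne' hx), hhom x hx, norm_smul, Real.norm_of_nonneg ht.le,
      smul_smul]
    have : (t * ‖x‖)⁻¹ * t = ‖x‖⁻¹ := by field_simp
    rw [this]; ring
  ext i j
  rw [Hess_apply hu (smul_ne_zero ht.ne' hx), Hess_apply hu hx]
  have h1 := pd_hom hu ht h0 (EuclideanSpace.single j 1)
  have h2 := pd_hom (pd_smooth hu) ht (k := 0) (by simpa using h1) (EuclideanSpace.single i 1) x hx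
  simpa using h2

/-- Pointwise consequences of the special Lagrangian equation in an eigenbasis. -/
theorem pointwise {n : ℕ} {u : EuclideanSpace ℝ (Fin n) → ℝ} (hu : ContDiffOn ℝ ∞ u {0}ᶜ)
    (hsym : ∀ x : EuclideanSpace ℝ (Fin n), x ≠ 0 → (Hess u x).IsHermitian) {c : ℝ}
    (hsol : ∀ (x : EuclideanSpace ℝ (Fin n)) (hx : x ≠ 0),
      ∑ i, Real.arctan ((hsym x hx).eigenvalues i) = c)
    {x : EuclideanSpace ℝ (Fin n)} (hx : x ≠ 0)
    {b : OrthonormalBasis (Fin n) ℝ (EuclideanSpace ℝ (Fin n))}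
    (hb : b = (hsym x hx).eigenvectorBasis) {l g : Fin n → ℝ} (hl : l = (hsym x hx).eigenvalues)
    (hg : ∀ a, g a * (1 + l a ^ 2) = 1) (k : Fin n) :
    (pd (b k) (lvol u) x = ∑ a, l a * g a * pd (b k) (pd (b a) (pd (b a) u)) x ∧
      0 = ∑ a, g a * pd (b k) (pd (b a) (pd (b a) u)) x) ∧
    pd (b k) (pd (b k) (lvol u)) x =
      ∑ a, l a * g a * pd (b k) (pd (b k) (pd (b a) (pd (b a) u))) x +
      ∑ a, ∑ d, g a * g d * (1 - l a * l d) * pd (b k) (pd (b a) (pd (b d) u)) x ^ 2 ∧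
    0 = ∑ a, g a * pd (b k) (pd (b k) (pd (b a) (pd (b a) u))) x -
      ∑ a, ∑ d, g a * g d * (l a + l d) * pd (b k) (pd (b a) (pd (b d) u)) x ^ 2 := by
  have hf := lvol_smooth hu hsym hsol
  have hsq : ∀ a d, pd (b k) (pd (b a) (pd (b d) u)) x ^ 2 =
      pd (b k) (pd (b a) (pd (b d) u)) x * pd (b k) (pd (b d) (pd (b a) u)) x := by
    intro a d
    rw [sq]
    congr 1
    exact pd_congr (fun y hy => pd_comm hu hy) hx
  have hx' : x + (0 : ℝ) • b k ≠ 0 := by simpa using hx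
  have key := log_det_diag (A := fun t => HessB u b (x + t • b k))
    (A1 := fun t => Matrix.of fun a d => pd (b k) (pd (b a) (pd (b d) u)) (x + t • b k))
    (A2 := Matrix.of fun a d => pd (b k) (pd (b k) (pd (b a) (pd (b d) u))) (x + (0 : ℝ) • b k))
    (φ := fun t => lvol u (x + t • b k)) (φ1 := fun t => pd (b k) (lvol u) (x + t • b k))
    (φ2 := pd (b k) (pd (b k) (lvol u)) (x + (0 : ℝ) • b k))
    (z := Complex.exp (Complex.I * c)) (Complex.exp_ne_zero _) (l := l) hg ?_ ?_ ?_ ?_ ?_ ?_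
  · simp only [Matrix.of_apply, zero_smul, add_zero] at key
    simp only [hsq]
    exact key
  · simp only [zero_smul, add_zero]
    rw [hb, hl]
    exact HessB_eigen hu hx (hsym x hx)
  · filter_upwards [line_ne hx (b k)] with t ht i j
    exact line_deriv (pd_smooth (pd_smooth hu)) x (b k) ht
  · intro i j
    exact line_deriv (pd_smooth (pd_smooth (pd_smooth hu))) x (b k) hx'
  · filter_upwards [line_ne hx (b k)] with t ht
    exact line_deriv hf x (b k) ht
  · exact line_deriv (pd_smooth hf) x (b k) hx'
  · filter_upwards [line_ne hx (b k)] with t ht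
    rw [cdet_basis hu b ht]
    exact cdet_eq hu ht (hsym _ ht) (hsol _ ht)

/-- The Jacobi identity for the logarithm of the volume element. -/
theorem jacobi {n : ℕ} {u : EuclideanSpace ℝ (Fin n) → ℝ} (hu : ContDiffOn ℝ ∞ u {0}ᶜ)
    (hsym : ∀ x : EuclideanSpace ℝ (Fin n), x ≠ 0 → (Hess u x).IsHermitian) {c : ℝ}
    (hsol : ∀ (x : EuclideanSpace ℝ (Fin n)) (hx : x ≠ 0),
      ∑ i, Real.arctan ((hsym x hx).eigenvalues i) = c)
    {x : EuclideanSpace ℝ (Fin n)} (hx : x ≠ 0)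
    {b : OrthonormalBasis (Fin n) ℝ (EuclideanSpace ℝ (Fin n))}
    (hb : b = (hsym x hx).eigenvectorBasis) {l g : Fin n → ℝ} (hl : l = (hsym x hx).eigenvalues)
    (hg : ∀ a, g a * (1 + l a ^ 2) = 1) :
    3 * ∑ k, g k * pd (b k) (pd (b k) (lvol u)) x =
      ∑ a, ∑ d, ∑ k, (3 + l a * l d + l d * l k + l k * l a) *
      (g a * g d * g k * pd (b k) (pd (b a) (pd (b d) u)) x ^ 2) := by
  have hp := fun k => pointwise hu hsym hsol hx hb hl hg k
  have hcomm2 : ∀ v w : EuclideanSpace ℝ (Fin n), ∀ y, y ≠ 0 → pd v (pd w u) y = pd w (pd v u) y :=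
    fun v w y hy => pd_comm hu hy
  refine jacobi_alg (F := fun k => pd (b k) (pd (b k) (lvol u)) x)
    (T := fun a d k => pd (b k) (pd (b a) (pd (b d) u)) x)
    (Q := fun a k => pd (b k) (pd (b k) (pd (b a) (pd (b a) u))) x) ?_ ?_ ?_
    (fun k => (hp k).2.1) (fun k => (hp k).2.2)
  · intro a d k
    exact pd_congr (hcomm2 _ _) hx
  · intro a d k
    show pd (b k) (pd (b a) (pd (b d) u)) x = pd (b d) (pd (b a) (pd (b k) u)) x
    rw [pd_congr (hcomm2 (b a) (b d)) hx, pd_comm (pd_smooth hu) hx,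
      pd_congr (hcomm2 (b k) (b a)) hx]
  · intro a k
    show pd (b k) (pd (b k) (pd (b a) (pd (b a) u))) x = pd (b a) (pd (b a) (pd (b k) (pd (b k) u))) x
    have h1 : ∀ v w : EuclideanSpace ℝ (Fin n), ∀ y, y ≠ 0 →
        pd v (pd w (pd w u)) y = pd w (pd w (pd v u)) y := by
      intro v w y hy
      rw [pd_comm (pd_smooth hu) hy]
      exact pd_congr (hcomm2 v w) hy
    have h2 : pd (b k) (pd (b k) (pd (b a) (pd (b a) u))) x =
        pd (b k) (pd (b a) (pd (b a) (pd (b k) u))) x := pd_congr (h1 _ _) hx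
    rw [h2, pd_comm (pd_smooth (pd_smooth hu)) hx]
    refine pd_congr (fun y hy => ?_) hx
    exact pd_comm (pd_smooth hu) hy

/-- For a homogeneous order-2 solution away from the origin satisfying the
constraint (3.1), the Laplacian `Δu = ∑ λᵢ` is constant (claim (3.3)). -/
theorem stmt_13 {n : ℕ} (hn : 2 ≤ n) (u : EuclideanSpace ℝ (Fin n) → ℝ) (c : ℝ)
    (hu : ContDiffOn ℝ (⊤ : ℕ∞) u {(0 : EuclideanSpace ℝ (Fin n))}ᶜ)
    (hhom : ∀ x : EuclideanSpace ℝ (Fin n), x ≠ 0 → u x = ‖x‖ ^ 2 * u (‖x‖⁻¹ • x))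
    (hsym : ∀ x : EuclideanSpace ℝ (Fin n), x ≠ 0 → (Hess u x).IsHermitian)
    (hsol : ∀ (x : EuclideanSpace ℝ (Fin n)) (hx : x ≠ 0),
      ∑ i, Real.arctan ((hsym x hx).eigenvalues i) = c)
    (hcond : ∀ (x : EuclideanSpace ℝ (Fin n)) (hx : x ≠ 0), ∀ i j : Fin n,
      0 ≤ 3 + ((hsym x hx).eigenvalues i) ^ 2 +
        2 * (hsym x hx).eigenvalues i * (hsym x hx).eigenvalues j) :
    ∀ (x y : EuclideanSpace ℝ (Fin n)) (hx : x ≠ 0) (hy : y ≠ 0),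
      ∑ i, (hsym x hx).eigenvalues i = ∑ i, (hsym y hy).eigenvalues i := by
  have hu : ContDiffOn ℝ ∞ u {0}ᶜ := hu
  have hf := lvol_smooth hu hsym hsol
  -- the maximum of the volume
  have hlh : ∀ {t : ℝ}, 0 < t → ∀ {x : EuclideanSpace ℝ (Fin n)}, x ≠ 0 →
      lvol u (t • x) = lvol u x := by
    intro t ht x hx
    rw [lvol, lvol, cdet, cdet, Hess_hom hu hhom ht hx]
  have : NeZero n := ⟨by omega⟩
  have hsph : ∀ x ∈ Metric.sphere (0 : EuclideanSpace ℝ (Fin n)) 1, x ≠ 0 := by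
    rintro x hx rfl
    simp at hx
  obtain ⟨p, hp, hpm⟩ := (isCompact_sphere (0 : EuclideanSpace ℝ (Fin n)) 1).exists_isMaxOn
    ⟨EuclideanSpace.single 0 1, by simp⟩ (hf.continuousOn.mono hsph)
  have hp0 := hsph p hp
  have hM : ∀ x, x ≠ 0 → lvol u x ≤ lvol u p := by
    intro x hx
    have hxn : 0 < ‖x‖ := norm_pos_iff.mpr hx
    rw [← hlh (inv_pos.mpr hxn) hx]
    apply hpm
    simp [norm_smul, hxn.ne']
  set gg : ∀ x : EuclideanSpace ℝ (Fin n), x ≠ 0 → Fin n → ℝ :=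
    fun x hx k => (1 + (hsym x hx).eigenvalues k ^ 2)⁻¹ with hgg
  have hg : ∀ x hx a, gg x hx a * (1 + (hsym x hx).eigenvalues a ^ 2) = 1 := by
    intro x hx a
    simp only [hgg]
    apply inv_mul_cancel₀
    positivity
  have hgpos : ∀ x hx a, 0 < gg x hx a := by
    intro x hx a
    simp only [hgg]
    positivity
  have hconst : ∀ x, x ≠ 0 → lvol u x = lvol u p := by
    refine strong_max hn hf (θ := (Real.exp (lvol u p) ^ 2)⁻¹) (by positivity) ?_ hM hp0 rfl
    intro x hx
    refine ⟨(hsym x hx).eigenvectorBasis, gg x hx, fun k => ⟨?_, ?_⟩, ?_⟩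
    · simp only [hgg]
      apply inv_anti₀ (by positivity)
      refine (eig_le hu hx (hsym x hx) k).trans ?_
      have := hM x hx
      gcongr
    · simp only [hgg]
      apply inv_le_one_of_one_le₀
      have := sq_nonneg ((hsym x hx).eigenvalues k)
      linarith
    · have := jacobi hu hsym hsol hx rfl rfl (hg x hx)
      have h2 : 0 ≤ 3 * ∑ k, gg x hx k * pd ((hsym x hx).eigenvectorBasis k)
          (pd ((hsym x hx).eigenvectorBasis k) (lvol u)) x := by
        rw [this]
        refine Finset.sum_nonneg fun a _ => Finset.sum_nonneg fun d _ =>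
          Finset.sum_nonneg fun k _ => ?_
        have h3 := three_nonneg (hcond x hx) a d k
        have h4 := hgpos x hx a
        have h5 := hgpos x hx d
        have h6 := hgpos x hx k
        positivity
      linarith
  -- derivatives of the volume vanish
  have hd1 : ∀ v x, x ≠ 0 → pd v (lvol u) x = 0 := by
    intro v x hx
    rw [pd_congr (g := fun _ => lvol u p) hconst hx]
    simp [pd]
  have hd2 : ∀ v x, x ≠ 0 → pd v (pd v (lvol u)) x = 0 := by
    intro v x hx
    rw [pd_congr (g := fun _ => 0) (hd1 v) hx]
    simp [pd]
  have hlap : ∀ (x : EuclideanSpace ℝ (Fin n)) (hx : x ≠ 0), ∀ k, ∑ a, pd ((hsym x hx).eigenvectorBasis k)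
      (pd ((hsym x hx).eigenvectorBasis a) (pd ((hsym x hx).eigenvectorBasis a) u)) x = 0 := by
    intro x hx k
    have hpw := pointwise hu hsym hsol hx rfl rfl (hg x hx) k
    have hj := jacobi hu hsym hsol hx rfl rfl (hg x hx)
    simp only [hd2 _ x hx, mul_zero, Finset.sum_const_zero] at hj
    have hnn : ∀ a d k, 0 ≤ (3 + (hsym x hx).eigenvalues a * (hsym x hx).eigenvalues d +
        (hsym x hx).eigenvalues d * (hsym x hx).eigenvalues k +
        (hsym x hx).eigenvalues k * (hsym x hx).eigenvalues a) *
        (gg x hx a * gg x hx d * gg x hx k * pd ((hsym x hx).eigenvectorBasis k)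
      (pd ((hsym x hx).eigenvectorBasis a) (pd ((hsym x hx).eigenvectorBasis d) u)) x ^ 2) := by
      intro a d k
      have h3 := three_nonneg (hcond x hx) a d k
      have h4 := hgpos x hx a
      have h5 := hgpos x hx d
      have h6 := hgpos x hx k
      positivity
    refine lap_alg ((hsym x hx).eigenvalues k) (hg x hx) hpw.1.2.symm
      (by rw [← hpw.1.1]; exact hd1 _ x hx) ?_
    intro a
    have z1 := (Finset.sum_eq_zero_iff_of_nonneg (fun a _ => Finset.sum_nonneg fun d _ =>
      Finset.sum_nonneg fun k _ => hnn a d k)).mp hj.symm a (Finset.mem_univ _)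
    have z2 := (Finset.sum_eq_zero_iff_of_nonneg (fun d _ =>
      Finset.sum_nonneg fun k _ => hnn a d k)).mp z1 a (Finset.mem_univ _)
    have z3 := (Finset.sum_eq_zero_iff_of_nonneg (fun k _ => hnn a a k)).mp z2 k
      (Finset.mem_univ _)
    rcases mul_eq_zero.mp z3 with h | h
    · apply mul_eq_zero_of_left
      linear_combination h
    · apply mul_eq_zero_of_right
      have h4 := (hgpos x hx a).ne'
      have h6 := (hgpos x hx k).ne'
      have h7 := (mul_eq_zero.mp h).resolve_left (mul_ne_zero (mul_ne_zero h4 h4) h6)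
      exact pow_eq_zero_iff (two_ne_zero) |>.mp h7
  -- conclusion
  have hH : ∀ i j, ContDiffOn ℝ ∞ (fun x => Hess u x i j) {0}ᶜ := fun i j =>
    (pd_smooth (pd_smooth hu)).congr fun x hx => Hess_apply hu hx i j
  have htr : ContDiffOn ℝ ∞ (fun x => (Hess u x).trace) {0}ᶜ := by
    simp only [Matrix.trace, Matrix.diag]
    exact ContDiffOn.sum fun i _ => hH i i
  have hfd : Set.EqOn (fderiv ℝ (fun x => (Hess u x).trace)) 0 {0}ᶜ := by
    intro x hx
    have hx : x ≠ 0 := hx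
    have h1 : ∀ k, pd ((hsym x hx).eigenvectorBasis k) (fun x => (Hess u x).trace) x = 0 := by
      intro k
      rw [pd_congr (g := fun y => ∑ a, pd ((hsym x hx).eigenvectorBasis a)
        (pd ((hsym x hx).eigenvectorBasis a) u) y) (fun y hy => by
          rw [← HessB_trace hu (hsym x hx).eigenvectorBasis hy]; rfl) hx, ← hlap x hx k]
      change fderiv ℝ (fun y => ∑ a, pd ((hsym x hx).eigenvectorBasis a)
        (pd ((hsym x hx).eigenvectorBasis a) u) y) x ((hsym x hx).eigenvectorBasis k) = _
      rw [fderiv_fun_sum fun a _ => smooth_diffAt (pd_smooth (pd_smooth hu)) hx]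
      simp only [sum_apply]
      rfl
    have h2 : (fderiv ℝ (fun x => (Hess u x).trace) x : EuclideanSpace ℝ (Fin n) →ₗ[ℝ] ℝ) = 0 := by
      apply (hsym x hx).eigenvectorBasis.toBasis.ext
      intro k
      have h1k := h1 k
      unfold pd at h1k
      simpa using h1k
    ext v
    exact congrArg (fun L : EuclideanSpace ℝ (Fin n) →ₗ[ℝ] ℝ => L v) h2
  have hconn : IsPreconnected ({0}ᶜ : Set (EuclideanSpace ℝ (Fin n))) :=
    (isConnected_compl_singleton_of_one_lt_rank (by
      rw [← Module.finrank_eq_rank]; simp; omega) 0).isPreconnected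
  intro x y hx hy
  have e := isOpen_compl_singleton.is_const_of_fderiv_eq_zero hconn
    (htr.differentiableOn (by simp)) hfd hx hy
  have t1 := (hsym x hx).trace_eq_sum_eigenvalues
  have t2 := (hsym y hy).trace_eq_sum_eigenvalues
  simp only [RCLike.ofReal_real_eq_id, id_eq] at t1 t2
  rw [← t1, ← t2]
  exact e
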